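/- There exist constants c₄, c₅ > 0 such that the following holds for all dimensions d ≥ 2, all θ ∈ (π/4, π/2), all κ ∈ (0,1), and all α ≥ 0 with α ≤ c₄(π/2 − θ). Let μ̃, e ∈ ℝ^d be unit vectors such that W_{θ,e} ⊆ H(μ̃) := {x ∈ ℝ^d : x·μ̃ ≥ 0}. For σ ∈ W_{θ/2,e} ∖ {0} define η_σ := cos(⟨σ,μ̃⟩ + θ/2), ρ_σ := |σ| sin(θ/2)(1 + κη_σ), and E_σ := π/2 − θ/2 − ⟨σ,μ̃⟩, and set S_{κ,α} := (∪ { B_{ρ_σ}(σ) : σ ∈ W_{θ/2,e}, E_σ ≥ α }) ∪ W_{θ,e}. Then there exist θ̄ ∈ (0,π/2) and a nonzero vector μ̄ ∈ ℝ^d such that W_{θ̄,μ̄} ⊆ S_{κ,α} and π/2 − θ̄ ≤ (1 − c₅κ)(π/2 − θ). -/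

import Mathlib

open Set Metric Real InnerProductGeometry
open scoped RealInnerProductSpace

noncomputable section

abbrev Euc (d : ℕ) := EuclideanSpace ℝ (Fin d)

/-- The cone W_{θ,μ} of vectors making angle at most θ with μ (together with 0). -/
def cone {d : ℕ} (θ : ℝ) (μ : Euc d) : Set (Euc d) := {p | p = 0 ∨ angle p μ ≤ θ}

section CircularCoordinates

variable {E : Type*} [NormedAddCommGroup E] [InnerProductSpace ℝ E]

theorem exists_unit_orthogonal [FiniteDimensional ℝ E] (hd : 2 ≤ Module.finrank ℝ E) (e : E) :
    ∃ f : E, ‖f‖ = 1 ∧ ⟪f, e⟫ = 0 := by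
  have hlt : Module.finrank ℝ (ℝ ∙ e) < Module.finrank ℝ E :=
    (finrank_span_le_card ({e} : Set E)).trans_lt (by simp; omega)
  have hne : (ℝ ∙ e)ᗮ ≠ ⊥ := fun h => by
    have := Submodule.finrank_add_finrank_orthogonal (ℝ ∙ e)
    rw [h, finrank_bot] at this
    omega
  obtain ⟨v, hv, hv0⟩ := Submodule.exists_mem_ne_zero_of_ne_bot hne
  refine ⟨(‖v‖⁻¹ : ℝ) • v, ?_, ?_⟩
  · rw [norm_smul, norm_inv, norm_norm, inv_mul_cancel₀ (norm_ne_zero_iff.2 hv0)]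
  · rw [real_inner_smul_left, real_inner_comm,
      Submodule.mem_orthogonal_singleton_iff_inner_right.1 hv, mul_zero]

theorem exists_eq_cos_smul_add_sin_smul [FiniteDimensional ℝ E]
    (hd : 2 ≤ Module.finrank ℝ E) {e : E} (he : ‖e‖ = 1) (v : E) :
    ∃ f : E, ‖f‖ = 1 ∧ ⟪f, e⟫ = 0 ∧
      v = ‖v‖ • (Real.cos (angle v e) • e + Real.sin (angle v e) • f) := by
  set φ := angle v e with hφ
  have hin : ⟪v, e⟫ = ‖v‖ * Real.cos φ := by
    have := cos_angle_mul_norm_mul_norm v e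
    rw [he] at this
    linarith
  set w := v - (‖v‖ * Real.cos φ) • e with hw
  have hwe : ⟪w, e⟫ = 0 := by
    rw [hw, inner_sub_left, real_inner_smul_left, real_inner_self_eq_norm_sq, he, hin]; ring
  have hwn : ‖w‖ = ‖v‖ * Real.sin φ := by
    have h0 : 0 ≤ ‖v‖ * Real.sin φ := mul_nonneg (norm_nonneg _) (sin_angle_nonneg v e)
    refine (sq_eq_sq₀ (norm_nonneg _) h0).1 ?_
    rw [hw, norm_sub_sq_real, real_inner_smul_right, hin, norm_smul, he, mul_one, norm_eq_abs,
      sq_abs]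
    linear_combination ‖v‖ ^ 2 * (-1) * Real.sin_sq_add_cos_sq φ
  by_cases h : w = 0
  · obtain ⟨f, hf, hfe⟩ := exists_unit_orthogonal hd e
    refine ⟨f, hf, hfe, ?_⟩
    rw [h, norm_zero] at hwn
    rw [smul_add, smul_smul, smul_smul, ← hwn, zero_smul, add_zero]
    exact sub_eq_zero.1 h
  · refine ⟨(‖w‖⁻¹ : ℝ) • w, ?_, ?_, ?_⟩
    · rw [norm_smul, norm_inv, norm_norm, inv_mul_cancel₀ (norm_ne_zero_iff.2 h)]
    · rw [real_inner_smul_left, hwe, mul_zero]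
    · rw [smul_add, smul_smul, smul_smul, ← hwn, smul_smul,
        mul_inv_cancel₀ (norm_ne_zero_iff.2 h), one_smul, hw]
      abel

theorem inner_cos_smul_add_sin_smul {e f g : E} (he : ‖e‖ = 1) (hf : ⟪f, e⟫ = 0)
    (hg : ⟪g, e⟫ = 0) (a b : ℝ) :
    ⟪Real.cos a • e + Real.sin a • f, Real.cos b • e + Real.sin b • g⟫ =
      Real.cos a * Real.cos b + Real.sin a * Real.sin b * ⟪f, g⟫ := by
  have hg' : ⟪e, g⟫ = 0 := by rw [real_inner_comm, hg]
  simp only [inner_add_left, inner_add_right, real_inner_smul_left, real_inner_smul_right, hf, hg',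
    real_inner_self_eq_norm_sq, he]
  ring

theorem norm_cos_smul_add_sin_smul {e f : E} (he : ‖e‖ = 1) (hf : ‖f‖ = 1) (hfe : ⟪f, e⟫ = 0)
    (a : ℝ) : ‖Real.cos a • e + Real.sin a • f‖ = 1 := by
  have h := inner_cos_smul_add_sin_smul he hfe hfe a a
  rw [real_inner_self_eq_norm_sq, real_inner_self_eq_norm_sq, hf] at h
  refine (sq_eq_sq₀ (norm_nonneg _) zero_le_one).1 ?_
  linarith [Real.sin_sq_add_cos_sq a]

theorem angle_cos_smul_add_sin_smul {e f : E} (he : ‖e‖ = 1) (hf : ‖f‖ = 1) (hfe : ⟪f, e⟫ = 0)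
    {a : ℝ} (h0 : 0 ≤ a) (hpi : a ≤ π) : angle (Real.cos a • e + Real.sin a • f) e = a := by
  rw [angle, norm_cos_smul_add_sin_smul he hf hfe, he, inner_add_left, real_inner_smul_left,
    real_inner_smul_left, hfe, real_inner_self_eq_norm_sq, he]
  simp [Real.arccos_cos h0 hpi]

/-- The point of the ray at angle `b` whose distance to `r` times the direction at angle `a` is
smallest relative to its norm. -/
theorem norm_sub_tangent_point {e f : E} (he : ‖e‖ = 1) (hf : ‖f‖ = 1) (hfe : ⟪f, e⟫ = 0)
    {a b r : ℝ} (hr : 0 ≤ r) (hsin : 0 ≤ Real.sin (a - b)) (hcos : 0 < Real.cos (a - b)) :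
    ‖r • (Real.cos a • e + Real.sin a • f) -
      (r / Real.cos (a - b)) • (Real.cos b • e + Real.sin b • f)‖ =
        r / Real.cos (a - b) * Real.sin (a - b) := by
  refine (sq_eq_sq₀ (norm_nonneg _) (by positivity)).1 ?_
  rw [norm_sub_sq_real, norm_smul, norm_smul, real_inner_smul_left, real_inner_smul_right,
    inner_cos_smul_add_sin_smul he hfe hfe, norm_cos_smul_add_sin_smul he hf hfe,
    norm_cos_smul_add_sin_smul he hf hfe, real_inner_self_eq_norm_sq, hf, one_pow,
    mul_one (Real.sin a * Real.sin b),
    ← Real.cos_sub]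
  simp only [norm_eq_abs, mul_one, sq_abs]
  field_simp
  linear_combination (-r ^ 2) * Real.sin_sq_add_cos_sq (a - b)

end CircularCoordinates

theorem half_le_sin {x : ℝ} (h0 : 0 ≤ x) (h1 : x ≤ π / 2) : x / 2 ≤ Real.sin x := by
  refine le_trans ?_ (Real.mul_le_sin h0 h1)
  have : (1 : ℝ) / 2 ≤ 2 / π := by
    rw [div_le_div_iff₀ two_pos Real.pi_pos]; linarith [Real.pi_lt_four]
  nlinarith

theorem quarter_le_sin_half {θ : ℝ} (h0 : π / 4 < θ) (h1 : θ < π / 2) :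
    1 / 4 ≤ Real.sin (θ / 2) := by
  refine le_trans ?_ (Real.mul_le_sin (by linarith [Real.pi_pos]) (by linarith [Real.pi_pos]))
  have hp := Real.pi_pos
  rw [div_mul_div_comm, div_le_div_iff₀ (by norm_num) (by positivity)]
  linarith

theorem angle_le_of_cone_subset_halfspace {d : ℕ} (hd : 2 ≤ d) {θ : ℝ} (h0 : 0 < θ)
    (h1 : θ < π / 2) {μ e : Euc d} (hμ : ‖μ‖ = 1) (he : ‖e‖ = 1)
    (hsub : cone θ e ⊆ {x : Euc d | 0 ≤ ⟪x, μ⟫}) : angle μ e ≤ π / 2 - θ := by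
  obtain ⟨f, hf, hfe, hμf⟩ := exists_eq_cos_smul_add_sin_smul (by simpa using hd) he μ
  rw [hμ, one_smul] at hμf
  have hnfe : ⟪-f, e⟫ = 0 := by rw [inner_neg_left, hfe, neg_zero]
  have hmem : Real.cos θ • e + Real.sin θ • (-f) ∈ cone θ e :=
    Or.inr (angle_cos_smul_add_sin_smul he (by rw [norm_neg, hf]) hnfe h0.le
      (by linarith [Real.pi_pos])).le
  have h := hsub hmem
  rw [Set.mem_ofPred_eq, hμf, inner_cos_smul_add_sin_smul he hnfe hfe, inner_neg_left,
    real_inner_self_eq_norm_sq, hf] at h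
  by_contra! hlt
  have := Real.cos_neg_of_pi_div_two_lt_of_lt (x := θ + angle μ e) (by linarith)
    (by linarith [angle_le_pi μ e])
  rw [Real.cos_add] at this
  linarith

/-- Directions not nearly opposite to `f` have a margin proportional to `β`. -/
theorem margin_le_of_neg_half_le_inner {d : ℕ} {θ δ : ℝ} (h0 : π / 4 < θ) (h1 : θ < π / 2)
    (hδ0 : 0 ≤ δ) (hδ : δ ≤ π / 2 - θ) {e f u : Euc d} (he : ‖e‖ = 1) (hf : ‖f‖ = 1)
    (hu : ‖u‖ = 1) (hfe : ⟪f, e⟫ = 0) (hue : ⟪u, e⟫ = 0) (hx : -(1 / 2) ≤ ⟪u, f⟫) :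
    (π / 2 - θ) / 16 ≤ π / 2 - θ / 2 -
      angle (Real.cos (θ / 2) • e + Real.sin (θ / 2) • u) (Real.cos δ • e + Real.sin δ • f) := by
  have hp := Real.pi_pos
  set s := Real.cos (θ / 2) • e + Real.sin (θ / 2) • u with hs
  set m := Real.cos δ • e + Real.sin δ • f with hm
  have hse : angle s e = θ / 2 :=
    angle_cos_smul_add_sin_smul he hu hue (by linarith) (by linarith)
  have hme : angle m e = δ := angle_cos_smul_add_sin_smul he hf hfe hδ0 (by linarith)
  have htri : angle s m ≤ θ / 2 + δ := by
    have := angle_le_angle_add_angle s e m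
    rwa [hse, angle_comm e m, hme] at this
  have hcos : Real.cos (angle s m) =
      Real.cos (θ / 2) * Real.cos δ + Real.sin (θ / 2) * Real.sin δ * ⟪u, f⟫ := by
    rw [cos_angle, hs, hm, inner_cos_smul_add_sin_smul he hue hfe,
      norm_cos_smul_add_sin_smul he hu hue, norm_cos_smul_add_sin_smul he hf hfe]
    simp
  have hlip : Real.cos (angle s m) - Real.cos (θ / 2 + δ) ≤ θ / 2 + δ - angle s m := by
    have := Real.abs_cos_sub_cos_le (angle s m) (θ / 2 + δ)
    rw [abs_of_nonpos (sub_nonpos.2 htri)] at this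
    linarith [le_abs_self (Real.cos (angle s m) - Real.cos (θ / 2 + δ))]
  rw [hcos, Real.cos_add] at hlip
  have hprod : 1 / 4 * (δ / 2) ≤ Real.sin (θ / 2) * Real.sin δ :=
    mul_le_mul (quarter_le_sin_half h0 h1) (half_le_sin hδ0 (by linarith)) (by linarith)
      (by linarith [quarter_le_sin_half h0 h1])
  nlinarith

/-- A cone tilted by `4 ε` towards `f` and widened by `ε` exceeds the original cone only in
directions not nearly opposite to `f`. -/
theorem neg_half_le_of_mem_tilted {θ ε φ x : ℝ} (h0 : π / 4 < θ) (h1 : θ < π / 2) (hε : 0 < ε)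
    (hε1 : 8 * ε ≤ π / 2 - θ) (hφ : θ < φ) (hφ1 : φ ≤ θ + 5 * ε)
    (h : Real.cos (θ + ε) ≤
      Real.cos φ * Real.cos (4 * ε) + Real.sin φ * Real.sin (4 * ε) * x) : -(1 / 2) ≤ x := by
  have hp := Real.pi_pos
  have hp4 := Real.pi_lt_four
  by_contra! hx
  have hcosθ : 0 < Real.cos θ := Real.cos_pos_of_mem_Ioo ⟨by linarith, h1⟩
  have hcosφ : Real.cos φ ≤ Real.cos θ :=
    Real.cos_le_cos_of_nonneg_of_le_pi (by linarith) (by linarith) hφ.le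
  have hsin : Real.sin θ ≤ Real.sin φ := by
    rw [← Real.cos_pi_div_two_sub, ← Real.cos_pi_div_two_sub φ, ← Real.cos_abs (π / 2 - φ)]
    exact Real.cos_le_cos_of_nonneg_of_le_pi (abs_nonneg _) (by linarith)
      (abs_le.2 ⟨by linarith, by linarith⟩)
  have hsc : Real.cos θ ≤ Real.sin θ := by
    rw [← Real.cos_pi_div_two_sub]
    exact Real.cos_le_cos_of_nonneg_of_le_pi (by linarith) (by linarith) (by linarith)
  have hs4 : 5 / 2 * ε ≤ Real.sin (4 * ε) := by
    refine le_trans ?_ (Real.mul_le_sin (by linarith) (by linarith))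
    have : (5 : ℝ) / 8 ≤ 2 / π := by
      rw [div_le_div_iff₀ (by norm_num) Real.pi_pos]; linarith [Real.pi_lt_d2]
    nlinarith
  have hc4 : 0 ≤ Real.cos (4 * ε) := (Real.cos_pos_of_mem_Ioo ⟨by linarith, by linarith⟩).le
  have hA : Real.cos φ * Real.cos (4 * ε) ≤ Real.cos θ :=
    (mul_le_mul_of_nonneg_right hcosφ hc4).trans
      (mul_le_of_le_one_right hcosθ.le (Real.cos_le_one _))
  have hB : Real.sin θ * (5 / 2 * ε) ≤ Real.sin φ * Real.sin (4 * ε) :=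
    mul_le_mul hsin hs4 (by linarith) (by linarith)
  have hθpos : 0 < Real.sin θ := by linarith
  have hC : Real.cos θ * (1 - ε ^ 2 / 2) ≤ Real.cos θ * Real.cos ε :=
    mul_le_mul_of_nonneg_left (Real.one_sub_sq_div_two_le_cos) hcosθ.le
  have hD : Real.sin θ * Real.sin ε ≤ Real.sin θ * ε :=
    mul_le_mul_of_nonneg_left (Real.sin_le hε.le) hθpos.le
  have hF : Real.cos θ * (ε ^ 2 / 2) ≤ Real.sin θ * (ε / 8) :=
    mul_le_mul hsc (by nlinarith) (by positivity) hθpos.le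
  have hG : 0 < Real.sin θ * ε := mul_pos hθpos hε
  have hH : Real.sin φ * Real.sin (4 * ε) * x ≤ Real.sin φ * Real.sin (4 * ε) * (-(1 / 2)) :=
    mul_le_mul_of_nonneg_left hx.le (by linarith)
  rw [Real.cos_add] at h
  linarith

/-- Intermediate cone lemma: there are universal constants `c₄, c₅ > 0` such that, in any
dimension `d ≥ 2`, for `θ ∈ (π/4,π/2)`, `κ ∈ (0,1)`, `0 ≤ α ≤ c₄(π/2−θ)`, and unit vectors
`μ̃, e` with `W_{θ,e} ⊆ H(μ̃)`, the enlarged set `S_{κ,α}` (union of the balls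
`B_{ρ_σ}(σ)` over nonzero `σ ∈ W_{θ/2,e}` with `E_σ ≥ α`, together with `W_{θ,e}`) contains a
cone `W_{θ̄,μ̄}` with `π/2 − θ̄ ≤ (1 − c₅κ)(π/2 − θ)`. -/
theorem intermediate_cone :
    ∃ c₄ c₅ : ℝ, 0 < c₄ ∧ 0 < c₅ ∧
      ∀ (d : ℕ), 2 ≤ d →
      ∀ (θ κ α : ℝ), θ ∈ Ioo (π / 4) (π / 2) → κ ∈ Ioo (0 : ℝ) 1 →
        0 ≤ α → α ≤ c₄ * (π / 2 - θ) →
      ∀ (μt e : Euc d), ‖μt‖ = 1 → ‖e‖ = 1 →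
        cone θ e ⊆ {x : Euc d | 0 ≤ ⟪x, μt⟫} →
        ∃ (θbar : ℝ) (μbar : Euc d), θbar ∈ Ioo 0 (π / 2) ∧ μbar ≠ 0 ∧
          cone θbar μbar ⊆
            ((⋃ σ ∈ {σ : Euc d | σ ∈ cone (θ / 2) e ∧ σ ≠ 0 ∧
                α ≤ π / 2 - θ / 2 - angle σ μt},
              ball σ (‖σ‖ * Real.sin (θ / 2) * (1 + κ * Real.cos (angle σ μt + θ / 2))))
              ∪ cone θ e) ∧
          π / 2 - θbar ≤ (1 - c₅ * κ) * (π / 2 - θ) := by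
  refine ⟨1 / 16, 1 / 1000, by norm_num, by norm_num, ?_⟩
  rintro d hd θ κ α ⟨hθ0, hθ1⟩ ⟨hκ0, hκ1⟩ hα0 hα1 μt e hμ he hsub
  have hp := Real.pi_pos
  have hfin : 2 ≤ Module.finrank ℝ (Euc d) := by simpa using hd
  have hδ := angle_le_of_cone_subset_halfspace hd (by linarith) hθ1 hμ he hsub
  have hδ0 := angle_nonneg μt e
  obtain ⟨f, hf, hfe, hμf⟩ := exists_eq_cos_smul_add_sin_smul hfin he μt
  rw [hμ, one_smul] at hμf
  set δ := angle μt e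
  set β := π / 2 - θ with hβ
  have hβ0 : 0 < β := by linarith
  set ε := κ * β / 1000 with hε
  have hε0 : 0 < ε := by positivity
  have hε1 : 1000 * ε ≤ β := by rw [hε]; nlinarith
  set m := Real.cos (4 * ε) • e + Real.sin (4 * ε) • f with hm
  have hm1 : ‖m‖ = 1 := norm_cos_smul_add_sin_smul he hf hfe _
  have hme : angle m e = 4 * ε :=
    angle_cos_smul_add_sin_smul he hf hfe (by linarith) (by linarith)
  refine ⟨θ + ε, m, ⟨by linarith, by linarith⟩, norm_ne_zero_iff.1 (by rw [hm1]; norm_num),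
    ?_, by rw [hε]; linarith⟩
  rintro p (rfl | hpm)
  · exact Or.inr (Or.inl rfl)
  by_cases hφ : angle p e ≤ θ
  · exact Or.inr (Or.inr hφ)
  rcases eq_or_ne p 0 with rfl | hp0
  · exact Or.inr (Or.inl rfl)
  left
  push Not at hφ
  have hφ1 : angle p e ≤ θ + 5 * ε := by
    have := angle_le_angle_add_angle p m e
    linarith
  obtain ⟨u, hu, hue, hpu⟩ := exists_eq_cos_smul_add_sin_smul hfin he p
  have hr : 0 < ‖p‖ := norm_pos_iff.2 hp0
  set φ := angle p e
  set r := ‖p‖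
  have hx : -(1 / 2) ≤ ⟪u, f⟫ := by
    refine neg_half_le_of_mem_tilted hθ0 hθ1 hε0 (by linarith) hφ hφ1 ?_
    rw [← inner_cos_smul_add_sin_smul he hue hfe]
    have hcos : Real.cos (angle p m) =
        ⟪Real.cos φ • e + Real.sin φ • u, Real.cos (4 * ε) • e + Real.sin (4 * ε) • f⟫ := by
      rw [hpu, angle_smul_left_of_pos _ _ hr, cos_angle, hm1,
        norm_cos_smul_add_sin_smul he hu hue]
      simp [hm]
    rw [← hcos]
    exact Real.cos_le_cos_of_nonneg_of_le_pi (angle_nonneg _ _) (by linarith) hpm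
  have hE := margin_le_of_neg_half_le_inner hθ0 hθ1 hδ0 hδ he hf hu hfe hue hx
  rw [← hμf, ← hβ] at hE
  set s := Real.cos (θ / 2) • e + Real.sin (θ / 2) • u with hs
  have hs1 : ‖s‖ = 1 := norm_cos_smul_add_sin_smul he hu hue _
  have hcosψ : 0 < Real.cos (φ - θ / 2) :=
    Real.cos_pos_of_mem_Ioo ⟨by linarith, by linarith⟩
  have hsinψ : 0 ≤ Real.sin (φ - θ / 2) :=
    Real.sin_nonneg_of_nonneg_of_le_pi (by linarith) (by linarith)
  have ht : 0 < r / Real.cos (φ - θ / 2) := div_pos hr hcosψ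
  have hnorm : ‖(r / Real.cos (φ - θ / 2)) • s‖ = r / Real.cos (φ - θ / 2) := by
    rw [norm_smul, hs1, mul_one, norm_eq_abs, abs_of_pos ht]
  refine Set.mem_iUnion₂.2 ⟨(r / Real.cos (φ - θ / 2)) • s, ⟨Or.inr ?_, ?_, ?_⟩, ?_⟩
  · rw [angle_smul_left_of_pos _ _ ht]
    exact (angle_cos_smul_add_sin_smul he hu hue (by linarith) (by linarith)).le
  · exact norm_ne_zero_iff.1 (by rw [hnorm]; exact ht.ne')
  · rw [angle_smul_left_of_pos _ _ ht]
    linarith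
  · rw [mem_ball, dist_eq_norm, hnorm, angle_smul_left_of_pos _ _ ht, hpu,
      norm_sub_tangent_point he hu hue hr.le hsinψ hcosψ, mul_assoc]
    refine mul_lt_mul_of_pos_left ?_ ht
    have hη : β / 32 ≤ Real.cos (angle s μt + θ / 2) := by
      rw [← Real.sin_pi_div_two_sub]
      have := half_le_sin (x := π / 2 - (angle s μt + θ / 2)) (by linarith)
        (by linarith [angle_nonneg s μt])
      linarith
    have hlip : Real.sin (φ - θ / 2) ≤ Real.sin (θ / 2) + 5 * ε := by
      have := Real.abs_sin_sub_sin_le (φ - θ / 2) (θ / 2)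
      rw [abs_of_nonneg (a := φ - θ / 2 - θ / 2) (by linarith)] at this
      linarith [le_abs_self (Real.sin (φ - θ / 2) - Real.sin (θ / 2))]
    have hgain : 1 / 4 * (κ * (β / 32)) ≤
        Real.sin (θ / 2) * (κ * Real.cos (angle s μt + θ / 2)) :=
      mul_le_mul (quarter_le_sin_half hθ0 hθ1) (mul_le_mul_of_nonneg_left hη hκ0.le)
        (by positivity) (by linarith [quarter_le_sin_half hθ0 hθ1])
    have hκβ : 0 < κ * β := mul_pos hκ0 hβ0
    linarith

end
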